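/- arXiv:1506.00184 — 9 statements merged into one kernel-verified Lean document; each statement's English description precedes it below -/
import Mathlib

section
/- Let ζ = exp(2πi/k). For every partition λ = (λ_1, …, λ_s) of n and every tuple (t_1, …, t_s) of k-th roots of unity, the polynomial ∏_{i=1}^s (1 − t_i x^{λ_i}) divides the polynomial D(x) = ∏_{0 ≤ i < k} ∏_{1 ≤ j ≤ n} (1 − ζ^i x^j) in ℂ[x]. (Equivalently, D(x) is a common denominator for all the rational functions f_{λ,t}(x) = ∏_{i=1}^s (1 − t_i x^{λ_i})^{-1}.) -/
open Polynomial Finset Complex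

lemma fac_ne_zero (t : ℂ) (l : ℕ) (hl : 0 < l) :
    (1 - Polynomial.C t * Polynomial.X ^ l : ℂ[X]) ≠ 0 := by
  intro h
  have := congrArg (Polynomial.eval 0) h
  simp [hl.ne'] at this

lemma fac_count_le (t a : ℂ) (l : ℕ) (hl : 0 < l) :
    (1 - Polynomial.C t * Polynomial.X ^ l : ℂ[X]).roots.count a
      ≤ if t * a ^ l = 1 then 1 else 0 := by
  split_ifs with h
  · rw [Polynomial.count_roots]
    by_contra! hc
    have h1 := ((Polynomial.one_lt_rootMultiplicity_iff_isRoot (fac_ne_zero t l hl)).1 hc).2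
    have ha : a ≠ 0 := by
      rintro rfl
      simp [hl.ne'] at h
    have ht : t ≠ 0 := by
      rintro rfl
      simp at h
    simp [Polynomial.IsRoot, Polynomial.derivative_X_pow, ha, ht, hl.ne'] at h1
  · rw [Nat.le_zero, Multiset.count_eq_zero]
    intro hm
    have := Polynomial.isRoot_of_mem_roots hm
    simp [Polynomial.IsRoot, sub_eq_zero] at this
    exact h this.symm

lemma fac_count_ge (t a : ℂ) (l : ℕ) (hl : 0 < l) (h : t * a ^ l = 1) :
    1 ≤ (1 - Polynomial.C t * Polynomial.X ^ l : ℂ[X]).roots.count a := by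
  rw [Multiset.one_le_count_iff_mem, Polynomial.mem_roots (fac_ne_zero t l hl)]
  simp [Polynomial.IsRoot, h]

/-- For every partition `λ` of `n` and tuple `t` of `k`-th roots of unity, the polynomial
`∏ i (1 - t_i x^{λ_i})` divides `D(x) = ∏_{0 ≤ i < k} ∏_{1 ≤ j ≤ n} (1 - ζ^i x^j)` in `ℂ[x]`,
where `ζ = exp(2πi/k)`. -/
theorem stmt_1 (n k : ℕ) (hn : 0 < n) (hk : 0 < k)
    (s : ℕ) (lam : Fin s → ℕ) (t : Fin s → ℂ)
    (hpos : ∀ i, 0 < lam i) (hdec : ∀ i j : Fin s, i ≤ j → lam j ≤ lam i)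
    (hsum : (∑ i, lam i) = n) (ht : ∀ i, t i ^ k = 1) :
    (∏ i, (1 - Polynomial.C (t i) * Polynomial.X ^ lam i)) ∣
      ∏ i ∈ Finset.range k, ∏ j ∈ Finset.Icc 1 n,
        (1 - Polynomial.C (Complex.exp (2 * Real.pi * Complex.I / k) ^ i)
          * Polynomial.X ^ j) := by
  have hz : IsPrimitiveRoot (Complex.exp (2 * Real.pi * Complex.I / k)) k :=
    Complex.isPrimitiveRoot_exp k hk.ne'
  generalize Complex.exp (2 * Real.pi * Complex.I / k) = z at hz
  have hP : (∏ i, (1 - Polynomial.C (t i) * Polynomial.X ^ lam i) : ℂ[X]) ≠ 0 :=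
    Finset.prod_ne_zero_iff.2 fun i _ => fac_ne_zero _ _ (hpos i)
  rw [Finset.prod_comm]
  have hQj : ∀ j ∈ Finset.Icc 1 n, (∏ i ∈ Finset.range k,
      (1 - Polynomial.C (z ^ i) * Polynomial.X ^ j) : ℂ[X]) ≠ 0 := fun j hj =>
    Finset.prod_ne_zero_iff.2 fun i _ => fac_ne_zero _ _ (Finset.mem_Icc.1 hj).1
  have hQ := Finset.prod_ne_zero_iff.2 hQj
  rw [(IsAlgClosed.splits _).dvd_iff_roots_le_roots hP hQ, Multiset.le_iff_count]
  intro a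
  rw [Polynomial.roots_prod _ _ hP, Polynomial.roots_prod _ _ hQ, Multiset.count_bind,
    Multiset.count_bind]
  change (∑ i, Multiset.count a _) ≤ ∑ j ∈ Finset.Icc 1 n, Multiset.count a _
  set S := Finset.univ.filter fun i => t i * a ^ lam i = 1 with hS
  have h1 : (∑ i, Multiset.count a
      (1 - Polynomial.C (t i) * Polynomial.X ^ lam i : ℂ[X]).roots) ≤ S.card := by
    rw [hS, Finset.card_filter]
    exact Finset.sum_le_sum fun i _ => fac_count_le _ _ _ (hpos i)
  refine h1.trans ?_
  rcases S.eq_empty_or_nonempty with he | ⟨i0, hi0⟩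
  · simp [he]
  set m := orderOf (a ^ k) with hm
  have hdvd : ∀ i ∈ S, m ∣ lam i := by
    intro i hi
    have h := (Finset.mem_filter.1 hi).2
    apply orderOf_dvd_of_pow_eq_one
    have := congrArg (· ^ k) h
    simp only [mul_pow, ht, one_mul, one_pow] at this
    rw [← pow_mul, mul_comm, pow_mul, this]
  have hm0 : 0 < m := Nat.pos_of_dvd_of_pos (hdvd i0 hi0) (hpos i0)
  have h2 : S.card ≤ n / m := by
    rw [Nat.le_div_iff_mul_le hm0, ← hsum, ← smul_eq_mul]
    calc S.card • m ≤ ∑ i ∈ S, lam i :=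
          Finset.card_nsmul_le_sum _ _ _ fun i hi => Nat.le_of_dvd (hpos i) (hdvd i hi)
      _ ≤ _ := Finset.sum_le_sum_of_subset (Finset.subset_univ _)
  refine h2.trans ?_
  rw [← Nat.Ioc_filter_dvd_card_eq_div, Finset.card_filter]
  have hI : Finset.Ioc 0 n = Finset.Icc 1 n := by
    ext x
    simp [Nat.succ_le_iff]
  rw [hI]
  refine Finset.sum_le_sum fun j hj => ?_
  split_ifs with hd
  swap
  · exact Nat.zero_le _
  have haj : (a ^ j) ^ k = 1 := by
    rw [← pow_mul, mul_comm, pow_mul]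
    exact orderOf_dvd_iff_pow_eq_one.1 hd
  have hne : a ^ j ≠ 0 := by
    intro h0
    simp [h0, hk.ne'] at haj
  haveI : NeZero k := ⟨hk.ne'⟩
  obtain ⟨i, hik, hi⟩ := hz.eq_pow_of_pow_eq_one (ξ := (a ^ j)⁻¹) (by rw [inv_pow, haj, inv_one])
  rw [Polynomial.roots_prod _ _ (hQj j hj), Multiset.count_bind]
  change 1 ≤ ∑ i ∈ Finset.range k, Multiset.count a _
  refine (fac_count_ge (z ^ i) a j (Finset.mem_Icc.1 hj).1 ?_).trans
    (Finset.single_le_sum (f := fun i => Multiset.count a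
      (1 - Polynomial.C (z ^ i) * Polynomial.X ^ j : ℂ[X]).roots)
      (fun _ _ => Nat.zero_le _) (Finset.mem_range.2 hik))
  rw [hi, inv_mul_cancel₀ hne]
end

section
/- For every positive integer m, the cardinality of W_m equals 1 + ∑_{t=2}^m ⌊m/t⌋, and consequently |W_m| ≥ m·log m − 2(m−1), where log denotes the natural logarithm. -/
open Finset

/-- `W m` is the set of partitions of `m` of the form `(a^b, 1^{m - ab})` with
`a ≥ 2` and `b ≥ 0` nonnegative integers. -/
def Wset (m : ℕ) : Set (Nat.Partition m) :=
  {lam | ∃ a b : ℕ, 2 ≤ a ∧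
    lam.parts = Multiset.replicate b a + Multiset.replicate (m - a * b) 1}

/-- The multiset `(a^b, 1^{m-ab})`, for a pair `⟨a, b⟩`. -/
def wParts (m : ℕ) (p : Σ _ : ℕ, ℕ) : Multiset ℕ :=
  Multiset.replicate p.2 p.1 + Multiset.replicate (m - p.1 * p.2) 1

/-- The index set of pairs `⟨a, b⟩` with `2 ≤ a ≤ m`, `1 ≤ b ≤ m / a`. -/
def wIdx (m : ℕ) : Finset (Σ _ : ℕ, ℕ) :=
  (Finset.Icc 2 m).sigma (fun t => Finset.Icc 1 (m / t))

theorem mem_wIdx (m a b : ℕ) : (⟨a, b⟩ : Σ _ : ℕ, ℕ) ∈ wIdx m ↔ 2 ≤ a ∧ 1 ≤ b ∧ a * b ≤ m := by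
  simp only [wIdx, Finset.mem_sigma, Finset.mem_Icc]
  constructor
  · rintro ⟨⟨h1, _⟩, h3, h4⟩
    rw [Nat.le_div_iff_mul_le (by omega)] at h4
    exact ⟨h1, h3, by rwa [mul_comm]⟩
  · rintro ⟨h1, h2, h3⟩
    refine ⟨⟨h1, by nlinarith⟩, h2, ?_⟩
    rw [Nat.le_div_iff_mul_le (by omega), mul_comm]
    exact h3

theorem count_wParts (m a b c : ℕ) (hc : 2 ≤ c) :
    (wParts m ⟨a, b⟩).count c = if a = c then b else 0 := by
  have : ¬ (1 = c) := by omega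
  simp [wParts, Multiset.count_replicate, this]

theorem wParts_injOn (m : ℕ) : Set.InjOn (wParts m) (wIdx m : Set (Σ _ : ℕ, ℕ)) := by
  rintro ⟨a, b⟩ h ⟨a', b'⟩ h' heq
  rw [Finset.mem_coe, mem_wIdx] at h h'
  have h1 := count_wParts m a b a h.1
  rw [heq, count_wParts m a' b' a h.1] at h1
  by_cases e : a' = a
  · subst e
    simp at h1
    rw [h1]
  · simp [e] at h1
    omega

theorem ones_notMem (m : ℕ) : Multiset.replicate m 1 ∉ (wIdx m).image (wParts m) := by
  intro h
  obtain ⟨⟨a, b⟩, hp, he⟩ := Finset.mem_image.1 h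
  rw [mem_wIdx] at hp
  have h1 := count_wParts m a b a hp.1
  have : ¬ (1 = a) := by omega
  rw [he] at h1
  simp [Multiset.count_replicate, this] at h1
  omega

theorem parts_image (m : ℕ) : Nat.Partition.parts '' Wset m =
    ((insert (Multiset.replicate m 1) ((wIdx m).image (wParts m)) : Finset (Multiset ℕ)) :
      Set (Multiset ℕ)) := by
  ext s
  simp only [Set.mem_image, Finset.mem_coe, Finset.mem_insert, Finset.mem_image]
  constructor
  · rintro ⟨lam, ⟨a, b, ha, hl⟩, rfl⟩
    have hs := lam.parts_sum
    rw [hl] at hs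
    simp [mul_comm b a] at hs
    rcases Nat.eq_zero_or_pos b with rfl | hb
    · left; simpa using hl
    · right
      exact ⟨⟨a, b⟩, (mem_wIdx m a b).2 ⟨ha, hb, by omega⟩, hl.symm⟩
  · have key : ∀ a b : ℕ, 2 ≤ a → a * b ≤ m → ∃ x ∈ Wset m, x.parts = wParts m ⟨a, b⟩ := by
      intro a b ha hab
      refine ⟨⟨wParts m ⟨a, b⟩, ?_, ?_⟩, ⟨a, b, ha, rfl⟩, rfl⟩
      · intro i hi
        rcases Multiset.mem_add.1 hi with h | h
        · have := Multiset.eq_of_mem_replicate h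
          simp only at this
          omega
        · have := Multiset.eq_of_mem_replicate h
          omega
      · simp [wParts, mul_comm b a]
        omega
    rintro (rfl | ⟨⟨a, b⟩, hp, rfl⟩)
    · obtain ⟨x, hx, h⟩ := key 2 0 le_rfl (by omega)
      exact ⟨x, hx, by simpa [wParts] using h⟩
    · rw [mem_wIdx] at hp
      exact key a b hp.1 hp.2.2

theorem ncard_Wset (m : ℕ) : (Wset m).ncard = 1 + ∑ t ∈ Finset.Icc 2 m, m / t := by
  have hinj : Function.Injective (Nat.Partition.parts (n := m)) :=
    fun x y h => Nat.Partition.ext h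
  rw [← Set.ncard_image_of_injective _ hinj, parts_image, Set.ncard_coe_finset,
    Finset.card_insert_of_notMem (ones_notMem m), Finset.card_image_of_injOn (wParts_injOn m),
    wIdx, Finset.card_sigma, add_comm]
  simp

theorem log_bound (m : ℕ) (hm : 0 < m) : (m : ℝ) * Real.log m - 2 * ((m : ℝ) - 1) ≤
    1 + ∑ t ∈ Finset.Icc 2 m, ((m / t : ℕ) : ℝ) := by
  have hH : Real.log m ≤ ∑ t ∈ Finset.Icc 1 m, (t : ℝ)⁻¹ := by
    have h := log_add_one_le_harmonic m
    rw [harmonic_eq_sum_Icc] at h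
    push_cast at h
    refine le_trans (Real.log_le_log (by exact_mod_cast hm) (by linarith)) h
  rw [← Finset.add_sum_Ioc_eq_sum_Icc (by omega : 1 ≤ m)] at hH
  have hI : Finset.Ioc 1 m = Finset.Icc 2 m := by ext; simp; omega
  rw [hI] at hH
  have h2 : ∑ t ∈ Finset.Icc 2 m, ((m : ℝ) * (t : ℝ)⁻¹ - 1) ≤
      ∑ t ∈ Finset.Icc 2 m, ((m / t : ℕ) : ℝ) := by
    refine Finset.sum_le_sum fun t _ => ?_
    have := (Nat.lt_floor_add_one ((m : ℝ) / t)).le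
    rw [Nat.floor_div_eq_div] at this
    rw [← div_eq_mul_inv]
    linarith
  rw [Finset.sum_sub_distrib, ← Finset.mul_sum] at h2
  have h3 : (∑ t ∈ Finset.Icc 2 m, (1 : ℝ)) = (m : ℝ) - 1 := by
    simp
    rw [Nat.cast_sub (by omega)]
    push_cast
    ring
  rw [h3] at h2
  have h4 := mul_le_mul_of_nonneg_left hH (Nat.cast_nonneg (α := ℝ) m)
  simp only [Nat.cast_one, inv_one, mul_add, mul_one] at h4
  linarith

/-- `|W_m| = 1 + ∑_{t=2}^m ⌊m/t⌋`, and consequently `|W_m| ≥ m·log m − 2(m−1)`. -/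
theorem stmt_4 (m : ℕ) (hm : 0 < m) :
    (Wset m).ncard = 1 + ∑ t ∈ Finset.Icc 2 m, m / t ∧
    (m : ℝ) * Real.log m - 2 * ((m : ℝ) - 1) ≤ ((Wset m).ncard : ℝ) := by
  refine ⟨ncard_Wset m, ?_⟩
  rw [ncard_Wset]
  push_cast
  have h := log_bound m hm
  exact h
end

section
/- For every integer k ≥ 2 and every positive integer n, E(n,k) = n + 1, where E(n,k) is the dimension of the ℂ-vector space spanned by the polynomials g_{λ,t}(x) = ∏_{i=1}^s (1 − t_i (−1)^{λ_i − 1} x^{λ_i}), as λ = (λ_1, …, λ_s) ranges over all partitions of n and t = (t_1, …, t_s) over all tuples of k-th roots of unity. -/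
open Polynomial Finset

/-- The set of polynomials `g_{λ,t}(x) = ∏ i (1 - t_i (−1)^{λ_i − 1} x^{λ_i})`, as
`λ = (λ_1, …, λ_s)` ranges over partitions of `n` and `t = (t_1, …, t_s)` over tuples of
`k`-th roots of unity. -/
def extPowerSet (n k : ℕ) : Set (Polynomial ℂ) :=
  {g | ∃ (s : ℕ) (lam : Fin s → ℕ) (t : Fin s → ℂ),
    (∀ i, 0 < lam i) ∧ (∀ i j : Fin s, i ≤ j → lam j ≤ lam i) ∧ (∑ i, lam i) = n ∧
    (∀ i, t i ^ k = 1) ∧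
    g = ∏ i, (1 - Polynomial.C (t i * (-1 : ℂ) ^ (lam i - 1)) * Polynomial.X ^ lam i)}

theorem extPowerSet_le (n k : ℕ) :
    Submodule.span ℂ (extPowerSet n k) ≤ Polynomial.degreeLT ℂ (n + 1) := by
  rw [Submodule.span_le]
  rintro g ⟨s, lam, t, -, -, hsum, -, rfl⟩
  rw [SetLike.mem_coe, Polynomial.mem_degreeLT]
  refine lt_of_le_of_lt (b := (n : WithBot ℕ)) ?_ (by exact_mod_cast Nat.lt_succ_self n)
  refine (Polynomial.degree_prod_le _ _).trans ?_
  rw [← hsum]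
  push_cast
  refine Finset.sum_le_sum fun i _ => ?_
  refine (Polynomial.degree_sub_le _ _).trans (max_le ?_ (Polynomial.degree_C_mul_X_pow_le _ _))
  exact Polynomial.degree_one_le.trans (by exact_mod_cast Nat.zero_le _)

open scoped Pointwise in
theorem le_extPowerSet (n k : ℕ) (hk : 2 ≤ k) :
    Polynomial.degreeLT ℂ (n + 1) ≤ Submodule.span ℂ (extPowerSet n k) := by
  obtain ⟨z, hz⟩ : ∃ z : ℂ, IsPrimitiveRoot z k :=
    ⟨_, Complex.isPrimitiveRoot_exp k (by omega)⟩
  have hz1 : z - 1 ≠ 0 := sub_ne_zero.mpr (hz.ne_one (by omega))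
  let A : Set (Polynomial ℂ) := {p | ∃ t : ℂ, t ^ k = 1 ∧ p = 1 - C t * X}
  have hA : A ^ n ⊆ extPowerSet n k := by
    intro p hp
    rw [Set.mem_pow] at hp
    obtain ⟨f, rfl⟩ := hp
    choose t ht hf using fun i => (f i).2
    refine ⟨n, fun _ => 1, t, by simp, by simp, by simp, ht, ?_⟩
    rw [List.prod_ofFn]
    refine Finset.prod_congr rfl fun i _ => ?_
    rw [hf i]
    simp
  have h1 : (1 - C 1 * X : Polynomial ℂ) ∈ Submodule.span ℂ A :=
    Submodule.subset_span ⟨1, by simp, rfl⟩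
  have h2 : (1 - C z * X : Polynomial ℂ) ∈ Submodule.span ℂ A :=
    Submodule.subset_span ⟨z, hz.pow_eq_one, rfl⟩
  have hX : (X : Polynomial ℂ) ∈ Submodule.span ℂ A := by
    have h := Submodule.smul_mem _ (z - 1)⁻¹ (Submodule.sub_mem _ h1 h2)
    convert h using 1
    have : (1 - C 1 * X - (1 - C z * X) : Polynomial ℂ) = (z - 1) • X := by
      rw [Polynomial.smul_eq_C_mul, C_sub]; ring
    rw [this, smul_smul, inv_mul_cancel₀ hz1, one_smul]
  have hone : (1 : Polynomial ℂ) ∈ Submodule.span ℂ A := by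
    have h := Submodule.add_mem _ h1 hX
    simpa using h
  have hpow : Submodule.span ℂ A ^ n ≤ Submodule.span ℂ (extPowerSet n k) := by
    rw [Submodule.span_pow]
    exact Submodule.span_mono hA
  refine le_trans ?_ hpow
  rw [Polynomial.degreeLT_eq_span_X_pow, Submodule.span_le]
  intro p hp
  simp only [Finset.coe_image, Set.mem_image, Finset.coe_range, Set.mem_Iio] at hp
  obtain ⟨j, hj, rfl⟩ := hp
  have h := Submodule.mul_mem_mul (Submodule.pow_mem_pow _ hX j)
    (Submodule.pow_mem_pow _ hone (n - j))
  rw [← pow_add, one_pow, mul_one, Nat.add_sub_cancel' (by omega)] at h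
  exact h

/-- For every `k ≥ 2` and `n ≥ 1`, `E(n,k) = n + 1`. -/
theorem stmt_6 (n k : ℕ) (hn : 0 < n) (hk : 2 ≤ k) :
    Module.finrank ℂ (Submodule.span ℂ (extPowerSet n k)) = n + 1 := by
  rw [le_antisymm (extPowerSet_le n k) (le_extPowerSet n k hk),
    LinearEquiv.finrank_eq (Polynomial.degreeLTEquiv ℂ (n + 1))]
  simp
end

section
/- Let n be an even positive integer, k ≥ 2 an integer, and ζ = exp(2πi/k). Then the following n + 1 polynomials in ℂ[x] are linearly independent over ℂ: a_j(x) = (1 + (−1)^{n−j} x^{n−j})(1 + (−1)^j ζ x^j) for j = 1, …, n/2, b_j(x) = (1 + (−1)^{n−j} x^{n−j})(1 + (−1)^j ζ² x^j) for j = 1, …, n/2, and 1 − ζ x^n. -/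
open Polynomial Finset Complex

lemma coeff_aux (n d : ℕ) (hn : Even n) (hd : d ≤ n) (z : ℂ) (t : ℕ) :
    ((1 + Polynomial.C ((-1 : ℂ) ^ (n - d)) * Polynomial.X ^ (n - d))
      * (1 + Polynomial.C ((-1 : ℂ) ^ d * z) * Polynomial.X ^ d)).coeff t
    = (if t = 0 then 1 else 0) + (-1) ^ d * (if t = n - d then 1 else 0)
      + (-1) ^ d * z * (if t = d then 1 else 0) + z * (if t = n then 1 else 0) := by
  have hs : ((-1 : ℂ) ^ (n - d)) = (-1) ^ d := by
    have h1 : ((-1 : ℂ) ^ (n - d)) * (-1) ^ d = 1 := by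
      rw [← pow_add, Nat.sub_add_cancel hd, hn.neg_one_pow]
    have h2 : ((-1 : ℂ) ^ d) * (-1) ^ d = 1 := by
      rw [← pow_add, (Even.add_self d).neg_one_pow]
    have h3 : ((-1 : ℂ) ^ d) ≠ 0 := by
      intro h; rw [h] at h2; simp at h2
    exact mul_right_cancel₀ h3 (h1.trans h2.symm)
  have h2 : ((-1 : ℂ) ^ d) * (-1) ^ d = 1 := by
    rw [← pow_add, (Even.add_self d).neg_one_pow]
  have hp : ((1 + Polynomial.C ((-1 : ℂ) ^ (n - d)) * Polynomial.X ^ (n - d))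
      * (1 + Polynomial.C ((-1 : ℂ) ^ d * z) * Polynomial.X ^ d))
      = 1 + C ((-1 : ℂ) ^ d) * X ^ (n - d) + C ((-1 : ℂ) ^ d * z) * X ^ d + C z * X ^ n := by
    have e : (X : ℂ[X]) ^ n = X ^ (n - d) * X ^ d := by
      rw [← pow_add, Nat.sub_add_cancel hd]
    have e2 : C z = C ((-1 : ℂ) ^ d) * C ((-1 : ℂ) ^ d * z) := by
      rw [← C_mul, ← mul_assoc, h2, one_mul]
    rw [hs, e, e2]
    ring
  rw [hp]
  simp only [coeff_add, coeff_C_mul, coeff_X_pow, coeff_one]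

lemma zeta_ne (k : ℕ) (hk : 2 ≤ k) : Complex.exp (2 * Real.pi * Complex.I / k) ≠ 1 :=
  (Complex.isPrimitiveRoot_exp k (by omega)).ne_one (by omega)

lemma core (n : ℕ) (hn : 0 < n) (hneven : Even n) (ζ γ : ℂ) (hζ : ζ ≠ 1) (hζ0 : ζ ≠ 0)
    (α β : Fin (n / 2) → ℂ)
    (h : ∀ t : ℕ, (∑ j : Fin (n / 2), (α j * ((if t = 0 then 1 else 0)
          + (-1) ^ (j.1 + 1) * (if t = n - (j.1 + 1) then 1 else 0)
          + (-1) ^ (j.1 + 1) * ζ * (if t = j.1 + 1 then 1 else 0) + ζ * (if t = n then 1 else 0))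
        + β j * ((if t = 0 then 1 else 0)
          + (-1) ^ (j.1 + 1) * (if t = n - (j.1 + 1) then 1 else 0)
          + (-1) ^ (j.1 + 1) * ζ ^ 2 * (if t = j.1 + 1 then 1 else 0)
          + ζ ^ 2 * (if t = n then 1 else 0))))
        + γ * ((if t = 0 then 1 else 0) - ζ * (if t = n then 1 else 0)) = 0) :
    (∀ j, α j = 0 ∧ β j = 0) ∧ γ = 0 := by
  obtain ⟨m, rfl⟩ := hneven
  have hm : (m + m) / 2 = m := by omega
  have hz1 : ζ - 1 ≠ 0 := sub_ne_zero.mpr hζ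
  have small : ∀ j : Fin ((m + m) / 2), j.1 + 1 < m → α j = 0 ∧ β j = 0 := by
    intro j hj
    have hs : ((-1 : ℂ) ^ (j.1 + 1)) ≠ 0 := pow_ne_zero _ (by norm_num)
    have h1 := h (m + m - (j.1 + 1))
    have h2 := h (j.1 + 1)
    rw [Finset.sum_eq_single j] at h1 h2
    · rw [if_neg (by omega), if_pos rfl, if_neg (by omega), if_neg (by omega)] at h1
      rw [if_neg (by omega), if_neg (by omega), if_pos rfl, if_neg (by omega)] at h2
      have e1 : α j + β j = 0 := by
        apply mul_left_cancel₀ hs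
        linear_combination h1
      have e2 : α j + β j * ζ = 0 := by
        apply mul_left_cancel₀ (mul_ne_zero hs hζ0)
        linear_combination h2
      have e3 : β j = 0 := by
        apply mul_left_cancel₀ hz1
        linear_combination e2 - e1
      exact ⟨by linear_combination e1 - e3, e3⟩
    · intro b _ hb
      have hb' : b.1 ≠ j.1 := fun hh => hb (Fin.ext hh)
      have := b.2
      rw [if_neg (by omega), if_neg (by omega), if_neg (by omega), if_neg (by omega)]
      ring
    · simp
    · intro b _ hb
      have hb' : b.1 ≠ j.1 := fun hh => hb (Fin.ext hh)
      have := b.2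
      rw [if_neg (by omega), if_neg (by omega), if_neg (by omega), if_neg (by omega)]
      ring
    · simp
  let l : Fin ((m + m) / 2) := ⟨m - 1, by omega⟩
  have hl : l.1 + 1 = m := by simp only [l]; omega
  have key : ∀ t : ℕ, _ := fun t => by
    have h1 := h t
    rw [Finset.sum_eq_single l] at h1
    · exact h1
    · intro b _ hb
      have hb' : b.1 ≠ l.1 := fun hh => hb (Fin.ext hh)
      have := b.2
      obtain ⟨ha, hb2⟩ := small b (by omega)
      rw [ha, hb2]; ring
    · simp
  rw [hl] at key
  have hs : ((-1 : ℂ) ^ m) ≠ 0 := pow_ne_zero _ (by norm_num)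
  have k0 := key 0
  have k1 := key m
  have k2 := key (m + m)
  rw [if_pos rfl, if_neg (by omega), if_neg (by omega), if_neg (by omega)] at k0
  rw [if_neg (by omega), if_pos (by omega), if_pos rfl, if_neg (by omega)] at k1
  rw [if_neg (by omega), if_neg (by omega), if_neg (by omega), if_pos rfl] at k2
  have e1 : α l * (1 + ζ) + β l * (1 + ζ ^ 2) = 0 := by
    apply mul_left_cancel₀ hs
    linear_combination k1
  have e2 : α l + β l * ζ - γ = 0 := by
    apply mul_left_cancel₀ hζ0
    linear_combination k2
  have e3 : β l = 0 := by
    apply mul_left_cancel₀ (mul_ne_zero hz1 hz1)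
    linear_combination 2 * e1 - (1 + ζ) * (k0 + e2)
  have e4 : α l = 0 := by
    linear_combination (k0 + e2 - (1 + ζ) * e3) / 2
  refine ⟨fun j => ?_, by linear_combination k0 - e3 - e4⟩
  by_cases hj : j.1 + 1 < m
  · exact small j hj
  · have : j = l := Fin.ext (by have := j.2; omega)
    rw [this]; exact ⟨e4, e3⟩

/-- For `n` even positive, `k ≥ 2` and `ζ = exp(2πi/k)`, the `n + 1` polynomials
`a_j(x) = (1 + (−1)^{n−j} x^{n−j})(1 + (−1)^j ζ x^j)` for `j = 1, …, n/2`,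
`b_j(x) = (1 + (−1)^{n−j} x^{n−j})(1 + (−1)^j ζ² x^j)` for `j = 1, …, n/2`,
and `1 − ζ x^n`, are linearly independent over `ℂ`. -/
theorem stmt_7 (n k : ℕ) (hn : 0 < n) (hneven : Even n) (hk : 2 ≤ k) :
    LinearIndependent ℂ (fun i : Fin (n / 2) ⊕ Fin (n / 2) ⊕ Unit =>
      letI ζ : ℂ := Complex.exp (2 * Real.pi * Complex.I / k)
      match i with
      | Sum.inl j =>
          (1 + Polynomial.C ((-1 : ℂ) ^ (n - (j.1 + 1))) * Polynomial.X ^ (n - (j.1 + 1)))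
            * (1 + Polynomial.C ((-1 : ℂ) ^ (j.1 + 1) * ζ) * Polynomial.X ^ (j.1 + 1))
      | Sum.inr (Sum.inl j) =>
          (1 + Polynomial.C ((-1 : ℂ) ^ (n - (j.1 + 1))) * Polynomial.X ^ (n - (j.1 + 1)))
            * (1 + Polynomial.C ((-1 : ℂ) ^ (j.1 + 1) * ζ ^ 2) * Polynomial.X ^ (j.1 + 1))
      | Sum.inr (Sum.inr _) =>
          1 - Polynomial.C ζ * Polynomial.X ^ n) := by
  rw [Fintype.linearIndependent_iff]
  intro g hg
  have hc := core n hn hneven (Complex.exp (2 * Real.pi * Complex.I / k))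
    (g (Sum.inr (Sum.inr ()))) (zeta_ne k hk) (Complex.exp_ne_zero _)
    (fun j => g (Sum.inl j)) (fun j => g (Sum.inr (Sum.inl j))) (by
      intro t
      have h := congrArg (fun p => Polynomial.coeff p t) hg
      simp only [Fintype.sum_sum_type, Polynomial.coeff_add, Polynomial.finsetSum_coeff,
        Polynomial.coeff_smul, smul_eq_mul, Polynomial.coeff_zero, Finset.univ_unique,
        Finset.sum_singleton] at h
      rw [Finset.sum_add_distrib, add_assoc]
      refine Eq.trans ?_ h
      congr 1
      · refine Finset.sum_congr rfl fun j _ => ?_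
        rw [coeff_aux n _ hneven (by have := j.2; omega)]
      · congr 1
        · refine Finset.sum_congr rfl fun j _ => ?_
          rw [coeff_aux n _ hneven (by have := j.2; omega)]
        · simp [Polynomial.coeff_one, Polynomial.coeff_X_pow])
  rintro (j | j | u)
  · exact (hc.1 j).1
  · exact (hc.1 j).2
  · exact hc.2
end

section
/- Let p be a prime and n a positive integer. Then in ℤ[x], ∏_{k=1}^n (1 − x^{r_p(k)}) = (−1)^n · ∏_{1 ≤ d ≤ n, p ∤ d} Φ_d(x)^{⌊n/d⌋}, where Φ_d denotes the d-th cyclotomic polynomial. In particular, up to sign, the least common denominator g_p(x) = ∏_{1 ≤ k ≤ n, gcd(k,p)=1} Φ_k(x)^{⌊n/k⌋} of the rational functions f_λ(x) for λ ∈ X_p equals ∏_{k=1}^n (1 − x^{r_p(k)}). -/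
open Polynomial Finset

/-- For a prime `p` and `n ≥ 1`, in `ℤ[x]`:
`∏_{k=1}^n (1 − x^{r_p(k)}) = (−1)^n · ∏_{1 ≤ d ≤ n, p ∤ d} Φ_d(x)^{⌊n/d⌋}`,
where `r_p(k) = ordCompl[p] k` is the `p'`-part of `k` and `Φ_d` is the `d`-th
cyclotomic polynomial. -/
theorem stmt_8 (p n : ℕ) (hp : p.Prime) (hn : 0 < n) :
    ∏ k ∈ Finset.Icc 1 n, (1 - (Polynomial.X : Polynomial ℤ) ^ (ordCompl[p] k)) =
      (-1 : Polynomial ℤ) ^ n *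
        ∏ d ∈ (Finset.Icc 1 n).filter (fun d => ¬ p ∣ d),
          (Polynomial.cyclotomic d ℤ) ^ (n / d) := by
  have h1 : ∀ k ∈ Finset.Icc 1 n, (1 - (Polynomial.X : Polynomial ℤ) ^ (ordCompl[p] k)) =
      (-1) * ∏ d ∈ (Finset.Icc 1 n).filter (fun d => ¬ p ∣ d),
        if d ∣ k then Polynomial.cyclotomic d ℤ else 1 := by
    intro k hk
    rw [Finset.mem_Icc] at hk
    have hk0 : k ≠ 0 := by omega
    have hpos : 0 < ordCompl[p] k := Nat.ordCompl_pos p hk0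
    have hset : (ordCompl[p] k).divisors =
        ((Finset.Icc 1 n).filter (fun d => ¬ p ∣ d)).filter (fun d => d ∣ k) := by
      ext d
      simp only [Nat.mem_divisors, Finset.mem_filter, Finset.mem_Icc]
      constructor
      · rintro ⟨hd, -⟩
        have hdk : d ∣ k := hd.trans (Nat.ordCompl_dvd k p)
        have h3 := Nat.le_of_dvd (by omega) hdk
        have h4 := Nat.pos_of_dvd_of_pos hdk (by omega)
        exact ⟨⟨⟨h4, by omega⟩, fun h => Nat.not_dvd_ordCompl hp hk0 (h.trans hd)⟩, hdk⟩
      · rintro ⟨⟨-, hpd⟩, hdk⟩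
        refine ⟨?_, hpos.ne'⟩
        have hc : Nat.Coprime d (ordProj[p] k) :=
          (Nat.Coprime.pow_left _ ((Nat.Prime.coprime_iff_not_dvd hp).2 hpd)).symm
        apply hc.dvd_of_dvd_mul_left
        rw [Nat.ordProj_mul_ordCompl_eq_self]
        exact hdk
    rw [← Finset.prod_filter, ← hset, Polynomial.prod_cyclotomic_eq_X_pow_sub_one hpos]
    ring
  rw [Finset.prod_congr rfl h1, Finset.prod_mul_distrib, Finset.prod_comm]
  congr 1
  · simp
  · refine Finset.prod_congr rfl fun d _ => ?_
    rw [← Finset.prod_filter, Finset.prod_const]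
    congr 1
    exact Nat.Ioc_filter_dvd_card_eq_div n d
end

section
/- Let p be a prime and n a positive integer. Then ∑_{k=1}^n r_p(k) ≤ (p/(2p+2))·n² + n·(log n / log p + 1). Equivalently, the degree of the polynomial g_p(x) = ∏_{1 ≤ k ≤ n, gcd(k,p)=1} (1 − x^k)^{1 + ⌊log_p(n/k)⌋}, namely ∑_{1 ≤ k ≤ n, p ∤ k} k·(1 + ⌊log_p(n/k)⌋), is at most (p/(2p+2))·n² + n·(log_p n + 1). -/
open Finset

lemma aux_split (p n : ℕ) (hp : p.Prime) (f : ℕ → ℕ) :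
    ∑ k ∈ Finset.Icc 1 n, f k =
      ∑ k ∈ (Finset.Icc 1 n).filter (fun k => ¬ p ∣ k), f k
        + ∑ k ∈ Finset.Icc 1 (n / p), f (p * k) := by
  rw [← Finset.sum_filter_not_add_sum_filter (Finset.Icc 1 n) (fun k => p ∣ k)]
  congr 1
  symm
  have hp0 := hp.pos
  apply Finset.sum_bij (fun k _ => p * k)
  · intro k hk
    simp only [Finset.mem_Icc, Finset.mem_filter] at hk ⊢
    refine ⟨⟨Nat.mul_pos hp0 hk.1, ?_⟩, dvd_mul_right _ _⟩
    have := (Nat.le_div_iff_mul_le hp0).1 hk.2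
    rwa [mul_comm]
  · intro a _ b _ h
    exact Nat.eq_of_mul_eq_mul_left hp0 h
  · intro b hb
    simp only [Finset.mem_Icc, Finset.mem_filter] at hb
    obtain ⟨⟨h1, h2⟩, c, rfl⟩ := hb
    refine ⟨c, ?_, rfl⟩
    rw [Finset.mem_Icc]
    exact ⟨Nat.pos_of_mul_pos_left h1, (Nat.le_div_iff_mul_le hp0).2 (by rwa [mul_comm])⟩
  · intros; rfl

lemma aux_tri (n : ℕ) : ((∑ k ∈ Finset.Icc 1 n, k : ℕ) : ℝ) = n * (n + 1) / 2 := by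
  induction n with
  | zero => simp
  | succ n ih =>
    rw [Finset.sum_Icc_succ_top (by omega)]
    push_cast at ih ⊢
    rw [ih]; ring

lemma aux_bound (p : ℕ) (hp : p.Prime) (F : ℕ → ℕ) (h0 : F 0 = 0)
    (hF : ∀ n, 0 < n → F n =
      ∑ k ∈ (Finset.Icc 1 n).filter (fun k => ¬ p ∣ k), k + F (n / p)) (n : ℕ) :
    (F n : ℝ) ≤ (p : ℝ) / (2 * p + 2) * n ^ 2 + n := by
  induction n using Nat.strong_induction_on with
  | _ n ih =>
    rcases Nat.eq_zero_or_pos n with rfl | hn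
    · simp [h0]
    have hm := ih (n / p) (Nat.div_lt_self hn hp.one_lt)
    have h1 := aux_split p n hp (fun k => k)
    have h2 := hF n hn
    rw [← Finset.mul_sum] at h1
    have h1' : (n : ℝ) * (n + 1) / 2 =
        ((∑ k ∈ (Finset.Icc 1 n).filter (fun k => ¬ p ∣ k), k : ℕ) : ℝ)
          + p * (((n / p : ℕ) : ℝ) * ((n / p : ℕ) + 1) / 2) := by
      rw [← aux_tri, ← aux_tri, h1]; push_cast; ring
    have h2' : (F n : ℝ) = ((∑ k ∈ (Finset.Icc 1 n).filter (fun k => ¬ p ∣ k), k : ℕ) : ℝ)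
        + F (n / p) := by rw [h2]; push_cast; ring
    have hr : n % p + 1 ≤ p := Nat.mod_lt _ hp.pos
    have hnr : (n : ℝ) = p * (n / p : ℕ) + (n % p : ℕ) := by
      exact_mod_cast (Nat.div_add_mod n p).symm
    have hr' : ((n % p : ℕ) : ℝ) + 1 ≤ p := by exact_mod_cast hr
    have hr0 : (0 : ℝ) ≤ (n % p : ℕ) := by positivity
    have hm0 : (0 : ℝ) ≤ (n / p : ℕ) := by positivity
    have hp2 : (2 : ℝ) ≤ p := by exact_mod_cast hp.two_le
    generalize ((n / p : ℕ) : ℝ) = m at *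
    generalize ((n % p : ℕ) : ℝ) = r at *
    generalize ((∑ k ∈ (Finset.Icc 1 n).filter (fun k => ¬ p ∣ k), k : ℕ) : ℝ) = s at *
    have key : (n : ℝ) * (n + 1) / 2 - p * (m * (m + 1) / 2) +
        ((p : ℝ) / (2 * p + 2) * m ^ 2 + m) ≤ (p : ℝ) / (2 * p + 2) * n ^ 2 + n := by
      rw [hnr]
      generalize (p : ℝ) = q at *
      rw [← sub_nonneg]
      have : (q / (2 * q + 2) * (q * m + r) ^ 2 + (q * m + r)) -
          ((q * m + r) * ((q * m + r) + 1) / 2 - q * (m * (m + 1) / 2) +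
            (q / (2 * q + 2) * m ^ 2 + m)) =
          ((2 * q * m + r) * (q - 1 - r) + 2 * (2 * q * m + r) - m * (2 * q + 2)) / (2 * q + 2) := by
        field_simp
        ring
      rw [this]
      apply div_nonneg _ (by linarith)
      have a1 : 0 ≤ (2 * q * m + r) * (q - 1 - r) :=
        mul_nonneg (by positivity) (by linarith)
      nlinarith
    linarith

lemma aux_S (p : ℕ) (hp : p.Prime) (n : ℕ) :
    ∑ k ∈ Finset.Icc 1 n, ordCompl[p] k =
      ∑ k ∈ (Finset.Icc 1 n).filter (fun k => ¬ p ∣ k), k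
        + ∑ k ∈ Finset.Icc 1 (n / p), ordCompl[p] k := by
  rw [aux_split p n hp]
  congr 1
  · apply Finset.sum_congr rfl
    intro k hk
    rw [Nat.factorization_eq_zero_of_not_dvd (Finset.mem_filter.1 hk).2, pow_zero, Nat.div_one]
  · apply Finset.sum_congr rfl
    intro k _
    rw [Nat.ordCompl_mul, Nat.Prime.factorization_self hp]
    simp [Nat.div_self hp.pos]

lemma aux_D (p : ℕ) (hp : p.Prime) (n : ℕ) :
    ∑ k ∈ (Finset.Icc 1 n).filter (fun k => ¬ p ∣ k), k * (1 + Nat.log p (n / k)) =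
      ∑ k ∈ (Finset.Icc 1 n).filter (fun k => ¬ p ∣ k), k
        + ∑ k ∈ (Finset.Icc 1 (n / p)).filter (fun k => ¬ p ∣ k),
            k * (1 + Nat.log p (n / p / k)) := by
  simp_rw [mul_add, mul_one]
  rw [Finset.sum_add_distrib]
  congr 1
  symm
  have hsub : (Finset.Icc 1 (n / p)).filter (fun k => ¬ p ∣ k) ⊆
      (Finset.Icc 1 n).filter (fun k => ¬ p ∣ k) :=
    Finset.filter_subset_filter _ (Finset.Icc_subset_Icc_right (Nat.div_le_self _ _))
  rw [← Finset.sum_subset hsub (f := fun k => k * Nat.log p (n / k))]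
  · apply Finset.sum_congr rfl
    intro k hk
    simp only [Finset.mem_filter, Finset.mem_Icc] at hk
    have h1 : p ≤ n / k := by
      rw [Nat.le_div_iff_mul_le hk.1.1, mul_comm]
      exact (Nat.le_div_iff_mul_le hp.pos).1 hk.1.2
    rw [Nat.log_of_one_lt_of_le hp.one_lt h1, Nat.div_div_eq_div_mul, Nat.div_div_eq_div_mul,
      mul_comm p k]
    ring
  · intro k hk hk'
    simp only [Finset.mem_filter, Finset.mem_Icc] at hk hk'
    have h1 : n / k < p := by
      rw [Nat.div_lt_iff_lt_mul hk.1.1, mul_comm]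
      rw [← Nat.div_lt_iff_lt_mul hp.pos]
      by_contra h
      exact hk' ⟨⟨hk.1.1, not_lt.1 h⟩, hk.2⟩
    rw [Nat.log_of_lt h1, mul_zero]

/-- For a prime `p` and `n ≥ 1`: `∑_{k=1}^n r_p(k) ≤ (p/(2p+2))·n² + n·(log_p n + 1)`,
where `r_p(k) = ordCompl[p] k` is the `p'`-part of `k`; equivalently, the degree
`∑_{1 ≤ k ≤ n, p ∤ k} k·(1 + ⌊log_p(n/k)⌋)` of
`g_p(x) = ∏_{1 ≤ k ≤ n, p ∤ k} (1 − x^k)^{1 + ⌊log_p(n/k)⌋}` satisfies the same bound.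
Here `log_p x = log x / log p` and `⌊log_p(n/k)⌋ = Nat.log p (n / k)`. -/
theorem stmt_9 (p n : ℕ) (hp : p.Prime) (hn : 0 < n) :
    ((∑ k ∈ Finset.Icc 1 n, ordCompl[p] k : ℕ) : ℝ) ≤
        (p : ℝ) / (2 * p + 2) * n ^ 2 + n * (Real.log n / Real.log p + 1) ∧
    ((∑ k ∈ (Finset.Icc 1 n).filter (fun k => ¬ p ∣ k), k * (1 + Nat.log p (n / k)) : ℕ) : ℝ) ≤
        (p : ℝ) / (2 * p + 2) * n ^ 2 + n * (Real.log n / Real.log p + 1) := by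
  have hL : 0 ≤ (n : ℝ) * (Real.log n / Real.log p) :=
    mul_nonneg (by positivity) (div_nonneg (Real.log_natCast_nonneg n) (Real.log_natCast_nonneg p))
  have hS := aux_bound p hp (fun n => ∑ k ∈ Finset.Icc 1 n, ordCompl[p] k) (by simp)
    (fun n _ => aux_S p hp n) n
  have hD := aux_bound p hp (fun n => ∑ k ∈ (Finset.Icc 1 n).filter (fun k => ¬ p ∣ k),
    k * (1 + Nat.log p (n / k))) (by simp) (fun n _ => aux_D p hp n) n
  rw [mul_add, mul_one]
  exact ⟨by linarith, by linarith⟩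
end

section
/- For every prime p and every positive integer n, B(p,n) ≤ (p/(2p+2))·n² + n·(log n / log p) + 1. -/
open PowerSeries Finset

/-- The set of power series `f_λ(x) = ∏ j (1 - x^{λ_j})⁻¹` as `λ` ranges over the
partitions of `n` all of whose parts are coprime to `p`. -/
noncomputable def brauerSymSet (p n : ℕ) : Set (PowerSeries ℂ) :=
  {f | ∃ (s : ℕ) (lam : Fin s → ℕ),
    (∀ i, 0 < lam i) ∧ (∀ i j : Fin s, i ≤ j → lam j ≤ lam i) ∧ (∑ i, lam i) = n ∧
    (∀ i, Nat.Coprime (lam i) p) ∧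
    f = ∏ i, (1 - (PowerSeries.X : PowerSeries ℂ) ^ lam i)⁻¹}

namespace Brauer

open Polynomial in
lemma prod_X_pow_sub_one {ι : Type*} (s : Finset ι) (a : ι → ℕ) (p n : ℕ)
    (ha : ∀ i ∈ s, 0 < a i) (han : ∀ i ∈ s, a i ≤ n) (hc : ∀ i ∈ s, Nat.Coprime (a i) p) :
    ∏ i ∈ s, ((Polynomial.X : Polynomial ℂ) ^ a i - 1) =
      ∏ d ∈ (Finset.Icc 1 n).filter (fun d => Nat.Coprime d p),
        Polynomial.cyclotomic d ℂ ^ (s.filter (fun i => d ∣ a i)).card := by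
  have h1 : ∀ i ∈ s, ((Polynomial.X : Polynomial ℂ) ^ a i - 1) =
      ∏ d ∈ (Finset.Icc 1 n).filter (fun d => Nat.Coprime d p),
        if d ∣ a i then Polynomial.cyclotomic d ℂ else 1 := by
    intro i hi
    rw [← Polynomial.prod_cyclotomic_eq_X_pow_sub_one (ha i hi), ← Finset.prod_filter]
    apply Finset.prod_congr _ (fun _ _ => rfl)
    ext d
    simp only [Nat.mem_divisors, Finset.mem_filter, Finset.mem_Icc]
    constructor
    · rintro ⟨h, h0⟩
      exact ⟨⟨⟨Nat.pos_of_dvd_of_pos h (ha i hi), (Nat.le_of_dvd (ha i hi) h).trans (han i hi)⟩,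
        (hc i hi).coprime_dvd_left h⟩, h⟩
    · rintro ⟨_, h⟩
      exact ⟨h, (ha i hi).ne'⟩
  rw [Finset.prod_congr rfl h1, Finset.prod_comm]
  apply Finset.prod_congr rfl
  intro d _
  rw [← Finset.prod_filter, Finset.prod_const]

/-- the prime-to-`p` part -/
def pf (p m : ℕ) : ℕ := m / p ^ m.factorization p

lemma dvd_pf_iff {p m d : ℕ} (hd : Nat.Coprime d p) : d ∣ pf p m ↔ d ∣ m := by
  constructor
  · intro h
    exact h.trans (Nat.ordCompl_dvd m p)
  · intro h
    have h2 : p ^ m.factorization p * pf p m = m := Nat.ordProj_mul_ordCompl_eq_self m p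
    rw [← h2] at h
    exact (Nat.Coprime.pow_right _ hd).dvd_of_dvd_mul_left h

noncomputable def bigL (p n : ℕ) : Polynomial ℂ :=
  ∏ m ∈ Finset.Icc 1 n, ((Polynomial.X : Polynomial ℂ) ^ pf p m - 1)

def F (p n : ℕ) : ℕ := ∑ m ∈ Finset.Icc 1 n, pf p m

lemma pf_pos {p m : ℕ} (hm : 0 < m) : 0 < pf p m := Nat.ordCompl_pos p hm.ne'

lemma dvd_bigL {p n s : ℕ} (hp : p.Prime) (lam : Fin s → ℕ) (h0 : ∀ i, 0 < lam i)
    (hs : ∑ i, lam i = n) (hc : ∀ i, Nat.Coprime (lam i) p) :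
    ∏ i, ((Polynomial.X : Polynomial ℂ) ^ lam i - 1) ∣ bigL p n := by
  unfold bigL
  rw [prod_X_pow_sub_one Finset.univ lam p n (fun i _ => h0 i)
    (fun i _ => by rw [← hs]; exact Finset.single_le_sum (fun _ _ => Nat.zero_le _) (Finset.mem_univ i))
    (fun i _ => hc i)]
  rw [prod_X_pow_sub_one (Finset.Icc 1 n) (pf p) p n
    (fun i hi => pf_pos (Finset.mem_Icc.1 hi).1)
    (fun i hi => (Nat.div_le_self _ _).trans (Finset.mem_Icc.1 hi).2)
    (fun i hi => (Nat.coprime_ordCompl hp (Nat.pos_iff_ne_zero.1 (Finset.mem_Icc.1 hi).1)).symm)]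
  apply Finset.prod_dvd_prod_of_dvd
  intro d hd
  obtain ⟨hd1, hd2⟩ := Finset.mem_filter.1 hd
  apply pow_dvd_pow
  have e : (Finset.Icc 1 n).filter (fun i => d ∣ pf p i) = (Finset.Ioc 0 n).filter (fun i => d ∣ i) := by
    ext x
    simp only [Finset.mem_filter, dvd_pf_iff hd2, Finset.mem_Icc, Finset.mem_Ioc]
    rfl
  rw [e, Nat.Ioc_filter_dvd_card_eq_div]
  rw [Nat.le_div_iff_mul_le (Finset.mem_Icc.1 hd1).1]
  calc _ = ∑ i ∈ Finset.univ.filter (fun i => d ∣ lam i), d := by simp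
    _ ≤ ∑ i ∈ Finset.univ.filter (fun i => d ∣ lam i), lam i :=
        Finset.sum_le_sum (fun i hi => Nat.le_of_dvd (h0 i) (Finset.mem_filter.1 hi).2)
    _ ≤ ∑ i, lam i := Finset.sum_le_sum_of_subset (Finset.filter_subset _ _)
    _ = n := hs

lemma monic_prod {ι : Type*} (s : Finset ι) (a : ι → ℕ) (ha : ∀ i ∈ s, 0 < a i) :
    (∏ i ∈ s, ((Polynomial.X : Polynomial ℂ) ^ a i - 1)).Monic ∧
    (∏ i ∈ s, ((Polynomial.X : Polynomial ℂ) ^ a i - 1)).natDegree = ∑ i ∈ s, a i := by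
  have hm : ∀ i ∈ s, ((Polynomial.X : Polynomial ℂ) ^ a i - 1).Monic := fun i hi =>
    Polynomial.monic_X_pow_sub_C (1 : ℂ) (ha i hi).ne'
  refine ⟨Polynomial.monic_prod_of_monic _ _ hm, ?_⟩
  rw [Polynomial.natDegree_prod_of_monic _ _ hm]
  exact Finset.sum_congr rfl fun i _ => Polynomial.natDegree_X_pow_sub_C (r := (1 : ℂ))

lemma finrank_le {p n : ℕ} (hp : p.Prime) :
    Module.finrank ℂ (Submodule.span ℂ (brauerSymSet p n)) ≤ F p n - n + 1 := by
  obtain ⟨hLm, hLd⟩ := monic_prod (Finset.Icc 1 n) (pf p)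
    (fun i hi => pf_pos (Finset.mem_Icc.1 hi).1)
  change (bigL p n).Monic at hLm
  change (bigL p n).natDegree = F p n at hLd
  let φ : PowerSeries ℂ →ₗ[ℂ] PowerSeries ℂ := LinearMap.mulLeft ℂ ((bigL p n : Polynomial ℂ) : PowerSeries ℂ)
  have hφ : Function.Injective φ := by
    have : ((bigL p n : Polynomial ℂ) : PowerSeries ℂ) ≠ 0 := by
      intro h
      exact hLm.ne_zero (Polynomial.coe_eq_zero_iff.1 h)
    exact fun a b hab => mul_left_cancel₀ this hab
  let ψ : Polynomial ℂ →ₗ[ℂ] PowerSeries ℂ := (Polynomial.coeToPowerSeries.algHom ℂ).toLinearMap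
  have hψ : ∀ g : Polynomial ℂ, ψ g = (g : PowerSeries ℂ) := fun g => by
    simp [ψ, Polynomial.coeToPowerSeries.algHom_apply]
  set N := F p n - n + 1 with hN
  have hle : (Submodule.span ℂ (brauerSymSet p n)).map φ ≤
      (Polynomial.degreeLT ℂ N).map ψ := by
    rw [Submodule.map_span, Submodule.span_le]
    rintro _ ⟨f, ⟨s, lam, h0, -, hs, hc, rfl⟩, rfl⟩
    obtain ⟨g, hg⟩ := dvd_bigL hp lam h0 hs hc
    obtain ⟨hQm, hQd⟩ := monic_prod Finset.univ lam (fun i _ => h0 i)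
    rw [hs] at hQd
    have hg0 : g ≠ 0 := by
      rintro rfl
      rw [mul_zero] at hg
      exact hLm.ne_zero hg
    have hdeg : F p n = n + g.natDegree := by
      rw [← hLd, hg, Polynomial.natDegree_mul hQm.ne_zero hg0, hQd]
    refine ⟨Polynomial.C ((-1) ^ s) * g, ?_, ?_⟩
    · apply Polynomial.mem_degreeLT.2
      rw [Polynomial.degree_C_mul (by simp), Polynomial.degree_eq_natDegree hg0]
      exact_mod_cast (by omega : g.natDegree < N)
    · rw [hψ]
      change _ = ((bigL p n : Polynomial ℂ) : PowerSeries ℂ) * _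
      rw [hg, Polynomial.coe_mul, Polynomial.coe_mul, mul_right_comm, Polynomial.coe_C]
      congr 1
      have : ((∏ i, ((Polynomial.X : Polynomial ℂ) ^ lam i - 1) : Polynomial ℂ) : PowerSeries ℂ)
          = ∏ i, ((PowerSeries.X : PowerSeries ℂ) ^ lam i - 1) := by
        rw [← Polynomial.coeToPowerSeries.ringHom_apply, map_prod]
        exact Finset.prod_congr rfl fun i _ => by simp
      rw [this, ← Finset.prod_mul_distrib]
      have h2 : ∀ i ∈ (Finset.univ : Finset (Fin s)), ((PowerSeries.X : PowerSeries ℂ) ^ lam i - 1) *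
          (1 - (PowerSeries.X : PowerSeries ℂ) ^ lam i)⁻¹ = -1 := by
        intro i _
        rw [← neg_sub, neg_mul, PowerSeries.mul_inv_cancel]
        simp [(h0 i).ne']
      rw [Finset.prod_congr rfl h2]
      simp
  have e1 : Module.finrank ℂ ((Submodule.span ℂ (brauerSymSet p n)).map φ) =
      Module.finrank ℂ (Submodule.span ℂ (brauerSymSet p n)) :=
    (Submodule.equivMapOfInjective φ hφ _).finrank_eq.symm
  have e2 : Module.finrank ℂ (Polynomial.degreeLT ℂ N) = N := by
    rw [(Polynomial.degreeLTEquiv ℂ N).finrank_eq]; simp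
  have : Module.Finite ℂ (Polynomial.degreeLT ℂ N) :=
    Module.Finite.equiv (Polynomial.degreeLTEquiv ℂ N).symm
  rw [← e1]
  calc _ ≤ Module.finrank ℂ ((Polynomial.degreeLT ℂ N).map ψ) := Submodule.finrank_mono hle
    _ ≤ Module.finrank ℂ (Polynomial.degreeLT ℂ N) := Submodule.finrank_map_le _ _
    _ = N := e2

lemma F_rec {p : ℕ} (hp : p.Prime) (n : ℕ) :
    2 * F p n + p * ((n / p) * (n / p + 1)) = n * (n + 1) + 2 * F p (n / p) := by
  have hF : ∀ k, F p (k + 1) = F p k + pf p (k + 1) := fun k => by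
    unfold F; rw [Finset.sum_Icc_succ_top (by omega)]
  induction n with
  | zero => simp
  | succ n ih =>
    rw [hF n, Nat.succ_div]
    split_ifs with h
    · have hq : n + 1 = p * (n / p + 1) := by
        have h3 := Nat.succ_div (a := n) (b := p)
        rw [if_pos h] at h3
        rw [← h3, Nat.mul_div_cancel' h]
      have hpf : pf p (n + 1) = pf p (n / p + 1) := by
        rw [hq]
        unfold pf
        rw [Nat.factorization_mul hp.ne_zero (Nat.succ_ne_zero _)]
        simp only [Finsupp.add_apply, hp.factorization_self, pow_add, pow_one]
        rw [Nat.mul_div_mul_left _ _ hp.pos]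
      rw [hF, hpf]
      generalize n / p = q at *
      nlinarith
    · have hpf : pf p (n + 1) = n + 1 := by
        unfold pf
        rw [Nat.factorization_eq_zero_of_not_dvd h]; simp
      rw [hpf, add_zero]
      generalize n / p = q at *
      nlinarith

lemma F_le {p : ℕ} (hp : p.Prime) (n : ℕ) (hn : 0 < n) :
    (F p n : ℝ) ≤ (p : ℝ) / (2 * p + 2) * n ^ 2 + n * (Real.log n / Real.log p) + n := by
  induction n using Nat.strong_induction_on with
  | _ n ih =>
  have hrec : 2 * (F p n : ℝ) + p * (((n / p : ℕ) : ℝ) * ((n / p : ℕ) + 1)) =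
      n * (n + 1) + 2 * F p (n / p) := by exact_mod_cast F_rec hp n
  have hr : (n : ℝ) ≤ p * (n / p : ℕ) + p := by
    have := Nat.lt_mul_div_succ n hp.pos
    exact_mod_cast (by rw [mul_add] at this; omega : n ≤ p * (n / p) + p)
  have hr2 : (p : ℝ) * (n / p : ℕ) ≤ n := by exact_mod_cast Nat.mul_div_le n p
  have hp1 : (1 : ℝ) < p := by exact_mod_cast hp.one_lt
  have hn1 : (1 : ℝ) ≤ n := by exact_mod_cast hn
  have hlp : 0 < Real.log p := Real.log_pos hp1
  have hl : 0 ≤ Real.log n / Real.log p := div_nonneg (Real.log_nonneg hn1) hlp.le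
  have key : (F p (n / p) : ℝ) ≤ (p : ℝ) / (2 * p + 2) * (n / p : ℕ) ^ 2 +
      (n / p : ℕ) * (Real.log n / Real.log p) := by
    rcases Nat.eq_zero_or_pos (n / p) with h | h
    · rw [h]; simp [F]
    · have h1 := ih _ (Nat.div_lt_self hn hp.one_lt) h
      have hq : (0 : ℝ) < (n / p : ℕ) := by exact_mod_cast h
      have h2 : Real.log (n / p : ℕ) / Real.log p + 1 ≤ Real.log n / Real.log p := by
        rw [div_add_one hlp.ne']
        apply div_le_div_of_nonneg_right _ hlp.le
        rw [← Real.log_mul hq.ne' (by positivity)]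
        apply Real.log_le_log (by positivity)
        linarith
      nlinarith [mul_le_mul_of_nonneg_left h2 hq.le]
  have hq0 : (0 : ℝ) ≤ (n / p : ℕ) := Nat.cast_nonneg _
  generalize ((n / p : ℕ) : ℝ) = q at *
  generalize Real.log n / Real.log p = l at *
  generalize (n : ℝ) = x at *
  generalize (p : ℝ) = y at *
  have hqx : q ≤ x := by nlinarith
  have hql : q * l ≤ x * l := mul_le_mul_of_nonneg_right hqx hl
  obtain ⟨c, hc⟩ : ∃ c, c = y / (2 * y + 2) := ⟨_, rfl⟩
  have hcy : c * (2 * y + 2) = y := by rw [hc]; field_simp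
  rw [← hc] at key ⊢
  have main : (x ^ 2 / 2 - c * x ^ 2) - (y * q ^ 2 / 2 - c * q ^ 2) ≤ (x + y * q) / 2 := by
    have h3 : (x - y * q) * (x + y * q) ≤ (y + 1) * (x + y * q) :=
      mul_le_mul_of_nonneg_right (by linarith) (by nlinarith)
    have h4 : (2 * y + 2) * ((x ^ 2 / 2 - c * x ^ 2) - (y * q ^ 2 / 2 - c * q ^ 2)) =
        (x - y * q) * (x + y * q) := by
      linear_combination (-x ^ 2 + q ^ 2) * hcy
    have h5 : (2 * y + 2) * ((x ^ 2 / 2 - c * x ^ 2) - (y * q ^ 2 / 2 - c * q ^ 2)) ≤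
        (2 * y + 2) * ((x + y * q) / 2) := by rw [h4]; linarith
    exact le_of_mul_le_mul_left h5 (by linarith)
  nlinarith

end Brauer

/-- For every prime `p` and `n ≥ 1`, `B(p,n) ≤ (p/(2p+2))·n² + n·(log n / log p) + 1`. -/
theorem stmt_11 (p n : ℕ) (hp : p.Prime) (hn : 0 < n) :
    (Module.finrank ℂ (Submodule.span ℂ (brauerSymSet p n)) : ℝ) ≤
      (p : ℝ) / (2 * p + 2) * n ^ 2 + n * (Real.log n / Real.log p) + 1 := by
  have h1 : (Module.finrank ℂ (Submodule.span ℂ (brauerSymSet p n)) : ℝ) ≤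
      ((Brauer.F p n - n : ℕ) : ℝ) + 1 := by exact_mod_cast Brauer.finrank_le hp
  have h2 := Brauer.F_le hp n hn
  have hp1 : (1 : ℝ) < p := by exact_mod_cast hp.one_lt
  have hn1 : (1 : ℝ) ≤ n := by exact_mod_cast hn
  have hl : 0 ≤ Real.log n / Real.log p :=
    div_nonneg (Real.log_nonneg hn1) (Real.log_pos hp1).le
  have h0 : 0 ≤ (p : ℝ) / (2 * p + 2) * n ^ 2 + n * (Real.log n / Real.log p) := by positivity
  rcases le_total n (Brauer.F p n) with h | h
  · rw [Nat.cast_sub h] at h1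
    linarith
  · rw [Nat.sub_eq_zero_of_le h] at h1
    simp only [Nat.cast_zero] at h1
    linarith
end

section
/- For every prime p and every positive integer n, B(p,n) ≥ ((p−1)/p)·n·log n + n·(γ − 1 − (p−1)/p − γ/p), where γ is the Euler–Mascheroni constant and log denotes the natural logarithm. -/
open PowerSeries Finset

lemma coe_one_sub (e : ℕ) : ((1 - Polynomial.X ^ e : Polynomial ℂ) : PowerSeries ℂ) =
    1 - (X : PowerSeries ℂ) ^ e := by
  have := map_sub (Polynomial.coeToPowerSeries.ringHom (R := ℂ)) 1 (Polynomial.X ^ e)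
  simpa using this

/-- `f` is regular at `z` with value `v`. -/
def ValAt (z : ℂ) (f : PowerSeries ℂ) (v : ℂ) : Prop :=
  ∃ Q A : Polynomial ℂ, Q.eval z ≠ 0 ∧ (Q : PowerSeries ℂ) * f = (A : PowerSeries ℂ) ∧
    A.eval z = v * Q.eval z

lemma ValAt.poly (z : ℂ) (A : Polynomial ℂ) : ValAt z (A : PowerSeries ℂ) (A.eval z) :=
  ⟨1, A, by simp, by simp, by simp⟩

lemma ValAt.add {z : ℂ} {f g : PowerSeries ℂ} {v w : ℂ} (hf : ValAt z f v) (hg : ValAt z g w) :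
    ValAt z (f + g) (v + w) := by
  obtain ⟨Q, A, hQ, h, h'⟩ := hf
  obtain ⟨R, B, hR, k, k'⟩ := hg
  refine ⟨Q * R, A * R + B * Q, by simp [hQ, hR], ?_, ?_⟩
  · push_cast
    rw [← h, ← k]; ring
  · simp only [Polynomial.eval_add, Polynomial.eval_mul, h', k']; ring

lemma ValAt.mul {z : ℂ} {f g : PowerSeries ℂ} {v w : ℂ} (hf : ValAt z f v) (hg : ValAt z g w) :
    ValAt z (f * g) (v * w) := by
  obtain ⟨Q, A, hQ, h, h'⟩ := hf
  obtain ⟨R, B, hR, k, k'⟩ := hg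
  refine ⟨Q * R, A * B, by simp [hQ, hR], ?_, ?_⟩
  · push_cast
    rw [← h, ← k]; ring
  · simp only [Polynomial.eval_mul, h', k']; ring

lemma ValAt.pow {z : ℂ} {f : PowerSeries ℂ} {v : ℂ} (hf : ValAt z f v) (k : ℕ) :
    ValAt z (f ^ k) (v ^ k) := by
  induction k with
  | zero => simpa using ValAt.poly z 1
  | succ k ih => simpa [pow_succ] using ih.mul hf

lemma ValAt.smul {z : ℂ} {f : PowerSeries ℂ} {v : ℂ} (hf : ValAt z f v) (c : ℂ) :
    ValAt z (c • f) (c * v) := by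
  have := (ValAt.poly z (Polynomial.C c)).mul hf
  simpa [PowerSeries.smul_eq_C_mul] using this

lemma ValAt.sum {ι : Type*} {z : ℂ} {f : ι → PowerSeries ℂ} {v : ι → ℂ} (s : Finset ι)
    (hf : ∀ i ∈ s, ValAt z (f i) (v i)) : ValAt z (∑ i ∈ s, f i) (∑ i ∈ s, v i) := by
  classical
  induction s using Finset.induction_on with
  | empty => simpa using ValAt.poly z 0
  | insert a s ha ih =>
    rw [Finset.sum_insert ha, Finset.sum_insert ha]
    exact (hf a (by simp)).add (ih fun i hi => hf i (by simp [hi]))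

lemma ValAt.zero_eq {z v : ℂ} (h : ValAt z 0 v) : v = 0 := by
  obtain ⟨Q, A, hQ, h, h'⟩ := h
  have hA : A = 0 := by
    rw [mul_zero] at h
    exact_mod_cast h.symm
  subst hA
  simpa [hQ] using h'.symm

lemma one_sub_mul_inv {e : ℕ} (he : 0 < e) :
    (1 - (X : PowerSeries ℂ) ^ e) * (1 - (X : PowerSeries ℂ) ^ e)⁻¹ = 1 := by
  apply PowerSeries.mul_inv_cancel
  simp [he.ne']

lemma ValAt.one_sub (z : ℂ) (e : ℕ) : ValAt z (1 - (X : PowerSeries ℂ) ^ e) (1 - z ^ e) := by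
  have := ValAt.poly z (1 - Polynomial.X ^ e)
  rw [coe_one_sub] at this
  simpa using this

lemma ValAt.inv (z : ℂ) {e : ℕ} (he : 0 < e) (hz : z ^ e ≠ 1) :
    ValAt z (1 - (X : PowerSeries ℂ) ^ e)⁻¹ (1 - z ^ e)⁻¹ := by
  have h0 : (1 - z ^ e) ≠ 0 := sub_ne_zero.mpr (Ne.symm hz)
  refine ⟨1 - Polynomial.X ^ e, 1, by simpa using h0, ?_, ?_⟩
  · rw [coe_one_sub]; simpa using one_sub_mul_inv he
  · simp [h0]

/-- The series attached to the partition `(d^k, 1^(n-dk))`. -/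
noncomputable def famS (n d k : ℕ) : PowerSeries ℂ :=
  ((1 - (X : PowerSeries ℂ) ^ d)⁻¹) ^ k * ((1 - (X : PowerSeries ℂ) ^ 1)⁻¹) ^ (n - d * k)

lemma famS_mem {p n d k : ℕ} (hd : 2 ≤ d) (hdp : Nat.Coprime d p) (hk : d * k ≤ n) :
    famS n d k ∈ brauerSymSet p n := by
  refine ⟨k + (n - d * k), fun i => if i.val < k then d else 1, ?_, ?_, ?_, ?_, ?_⟩
  · intro i; dsimp only; split_ifs <;> omega
  · intro i j hij
    have : i.val ≤ j.val := hij
    dsimp only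
    split_ifs <;> omega
  · rw [Fin.sum_univ_add]
    simp
    rw [mul_comm k d]; omega
  · intro i; dsimp only; split_ifs
    · exact hdp
    · simp
  · rw [Fin.prod_univ_add]
    simp [famS]

lemma brauerSymSet_finite (p n : ℕ) : (brauerSymSet p n).Finite := by
  have : brauerSymSet p n ⊆ ⋃ s ∈ Set.Iic n,
      (fun lam : Fin s → ℕ => ∏ i, (1 - (X : PowerSeries ℂ) ^ lam i)⁻¹) ''
        (Set.Iic (fun _ => n)) := by
    rintro f ⟨s, lam, hpos, -, hsum, -, rfl⟩
    simp only [Set.mem_iUnion]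
    refine ⟨s, ?_, lam, ?_, rfl⟩
    · have : ∑ i : Fin s, 1 ≤ ∑ i, lam i := Finset.sum_le_sum fun i _ => hpos i
      simpa [hsum] using this
    · intro i
      rw [← hsum]
      exact Finset.single_le_sum (f := lam) (fun _ _ => Nat.zero_le _) (Finset.mem_univ i)
  refine Set.Finite.subset (Set.Finite.biUnion (Set.finite_Iic n) fun s _ => ?_) this
  exact (Set.finite_Iic _).image _

/-- index set -/
def idxS (p n : ℕ) : Finset (Σ _ : ℕ, ℕ) :=
  ((Icc 2 n).filter (fun d => ¬ p ∣ d)).sigma (fun d => Icc 1 (n / d))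

lemma famS_val {n d k D K : ℕ} (hd : 2 ≤ d) (hk : 1 ≤ k) (hK : 1 ≤ K) (z : ℂ)
    (hz : IsPrimitiveRoot z D) (hlt : d < D ∨ (d = D ∧ k < K)) :
    ValAt z ((1 - (X : PowerSeries ℂ) ^ D) ^ K * famS n d k) 0 := by
  have hz1 : z ^ 1 ≠ 1 := hz.pow_ne_one_of_pos_of_lt (by omega) (by omega)
  have h1 := (ValAt.inv z (e := 1) one_pos hz1).pow (n - d * k)
  have hD := hz.pow_eq_one
  rcases hlt with h | ⟨rfl, h⟩
  · have hzd : z ^ d ≠ 1 := hz.pow_ne_one_of_pos_of_lt (by omega) h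
    have := ((ValAt.one_sub z D).pow K).mul
      (((ValAt.inv z (e := d) (by omega) hzd).pow k).mul h1)
    have e : (1 - z ^ D) ^ K = 0 := by rw [hD]; simp; omega
    rw [e, zero_mul] at this
    exact this
  · have := ((ValAt.one_sub z d).pow (K - k)).mul h1
    have e : (1 - z ^ d) ^ (K - k) = 0 := by rw [hD]; simp; omega
    rw [e, zero_mul] at this
    convert this using 1
    have hKk : K = (K - k) + k := by omega
    unfold famS
    conv_lhs => rw [hKk]
    rw [pow_add, mul_assoc, ← mul_assoc (_ ^ k) (_ ^ k), ← mul_pow,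
      one_sub_mul_inv (by omega : 0 < d), one_pow, one_mul]

lemma famS_val_top {n d k : ℕ} (hd : 2 ≤ d) (z : ℂ) (hz : IsPrimitiveRoot z d) :
    ∃ v, v ≠ 0 ∧ ValAt z ((1 - (X : PowerSeries ℂ) ^ d) ^ k * famS n d k) v := by
  have hz1 : z ^ 1 ≠ 1 := hz.pow_ne_one_of_pos_of_lt (by omega) (by omega)
  have h1 := (ValAt.inv z (e := 1) one_pos hz1).pow (n - d * k)
  refine ⟨(1 - z ^ 1)⁻¹ ^ (n - d * k), ?_, ?_⟩
  rotate_left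
  · unfold famS
    rw [← mul_assoc (_ ^ k) (_ ^ k), ← mul_pow,
      one_sub_mul_inv (by omega : 0 < d), one_pow, one_mul]
    exact h1
  · exact pow_ne_zero _ (inv_ne_zero (sub_ne_zero.mpr (Ne.symm hz1)))

lemma famS_indep (p n : ℕ) :
    LinearIndependent ℂ (fun i : idxS p n => famS n i.1.1 i.1.2) := by
  classical
  rw [linearIndependent_iff']
  intro s g hs
  by_contra! hne
  have hbd : ∀ i : idxS p n, 2 ≤ i.1.1 ∧ 1 ≤ i.1.2 := by
    rintro ⟨⟨d, k⟩, hi⟩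
    simp only [idxS, Finset.mem_sigma, Finset.mem_filter, Finset.mem_Icc] at hi
    exact ⟨hi.1.1.1, hi.2.1⟩
  let t := s.filter (fun i => g i ≠ 0)
  have ht : t.Nonempty := by
    obtain ⟨i, hi, h⟩ := hne
    exact ⟨i, by simp [t, hi, h]⟩
  obtain ⟨m, hmt, hmax⟩ := t.exists_max_image (fun i => toLex (i.1.1, i.1.2)) ht
  have hgm : g m ≠ 0 := (Finset.mem_filter.mp hmt).2
  have hst : ∑ i ∈ t, g i • famS n i.1.1 i.1.2 = 0 := by
    rw [← hs]
    apply Finset.sum_subset (Finset.filter_subset _ _)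
    intro i hi hit
    have : g i = 0 := by
      by_contra h
      exact hit (by simp [t, hi, h])
    simp [this]
  obtain ⟨hd, hk⟩ := hbd m
  have hz := Complex.isPrimitiveRoot_exp m.1.1 (by omega)
  set z := Complex.exp (2 * Real.pi * Complex.I / (m.1.1 : ℂ)) with hzdef
  obtain ⟨v, hv, hval⟩ := famS_val_top (n := n) (k := m.1.2) hd z hz
  have key : ValAt z (∑ i ∈ t, g i • ((1 - (X : PowerSeries ℂ) ^ m.1.1) ^ m.1.2 *
      famS n i.1.1 i.1.2)) (∑ i ∈ t, g i * (if i = m then v else 0)) := by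
    apply ValAt.sum
    intro i hi
    apply ValAt.smul
    split_ifs with him
    · subst him; exact hval
    · have := hmax i hi
      rw [Prod.Lex.toLex_le_toLex] at this
      refine famS_val (hbd i).1 (hbd i).2 hk z hz ?_
      rcases this with h | ⟨h, h'⟩
      · exact Or.inl h
      · refine Or.inr ⟨h, lt_of_le_of_ne h' fun h'' => him ?_⟩
        apply Subtype.ext
        exact Sigma.ext h (heq_of_eq h'')
  have e : ∑ i ∈ t, g i • ((1 - (X : PowerSeries ℂ) ^ m.1.1) ^ m.1.2 * famS n i.1.1 i.1.2) = 0 := by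
    simp_rw [← mul_smul_comm]
    rw [← Finset.mul_sum, hst, mul_zero]
  rw [e] at key
  have := key.zero_eq
  simp [hmt, hgm, hv] at this

lemma finrank_lower (p n : ℕ) (hp : p.Prime) :
    ∑ d ∈ (Icc 2 n).filter (fun d => ¬ p ∣ d), n / d ≤
      Module.finrank ℂ (Submodule.span ℂ (brauerSymSet p n)) := by
  have hfin := brauerSymSet_finite p n
  have : FiniteDimensional ℂ (Submodule.span ℂ (brauerSymSet p n)) :=
    FiniteDimensional.span_of_finite ℂ hfin
  have hmem : ∀ i : idxS p n, famS n i.1.1 i.1.2 ∈ Submodule.span ℂ (brauerSymSet p n) := by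
    rintro ⟨⟨d, k⟩, hi⟩
    simp only [idxS, Finset.mem_sigma, Finset.mem_filter, Finset.mem_Icc] at hi
    apply Submodule.subset_span
    apply famS_mem hi.1.1.1
    · exact ((Nat.Prime.coprime_iff_not_dvd hp).mpr hi.1.2).symm
    · rw [mul_comm]
      exact (Nat.le_div_iff_mul_le (by omega)).mp hi.2.2
  have hli : LinearIndependent ℂ (fun i : idxS p n =>
      (⟨famS n i.1.1 i.1.2, hmem i⟩ : Submodule.span ℂ (brauerSymSet p n))) :=
    LinearIndependent.of_comp (Submodule.subtype _) (famS_indep p n)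
  have := hli.fintype_card_le_finrank
  rw [Fintype.card_coe, idxS, Finset.card_sigma] at this
  simpa using this

lemma sum_mult (p n : ℕ) (hp : 0 < p) (F : ℕ → ℝ) :
    ∑ d ∈ (Icc 1 n).filter (fun d => p ∣ d), F d = ∑ e ∈ Icc 1 (n / p), F (p * e) := by
  symm
  apply Finset.sum_bij (fun e _ => p * e)
  · intro e he
    simp only [Finset.mem_filter, Finset.mem_Icc] at he ⊢
    refine ⟨⟨Nat.mul_pos hp he.1, ?_⟩, dvd_mul_right _ _⟩
    rw [mul_comm]
    exact (Nat.le_div_iff_mul_le hp).mp he.2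
  · intro a _ b _ h
    exact Nat.eq_of_mul_eq_mul_left hp h
  · intro b hb
    simp only [Finset.mem_filter, Finset.mem_Icc] at hb
    obtain ⟨⟨h1, h2⟩, c, rfl⟩ := hb
    refine ⟨c, ?_, rfl⟩
    simp only [Finset.mem_Icc]
    refine ⟨Nat.pos_of_mul_pos_left h1, ?_⟩
    rw [Nat.le_div_iff_mul_le hp, mul_comm]
    exact h2
  · intros; rfl

lemma harm_sum (m : ℕ) : ∑ d ∈ Icc 1 m, ((d : ℝ))⁻¹ = (harmonic m : ℝ) := by
  rw [harmonic_eq_sum_Icc]; push_cast; rfl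

/-- For every prime `p` and `n ≥ 1`,
`B(p,n) ≥ ((p−1)/p)·n·log n + n·(γ − 1 − (p−1)/p − γ/p)`, where `γ` is the
Euler–Mascheroni constant. -/
theorem stmt_12 (p n : ℕ) (hp : p.Prime) (hn : 0 < n) :
    ((p : ℝ) - 1) / p * n * Real.log n +
        n * (Real.eulerMascheroniConstant - 1 - ((p : ℝ) - 1) / p
          - Real.eulerMascheroniConstant / p) ≤
      (Module.finrank ℂ (Submodule.span ℂ (brauerSymSet p n)) : ℝ) := by
  have h0 : ((∑ d ∈ (Icc 2 n).filter (fun d => ¬ p ∣ d), n / d : ℕ) : ℝ) ≤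
      (Module.finrank ℂ (Submodule.span ℂ (brauerSymSet p n)) : ℝ) := by
    exact_mod_cast finrank_lower p n hp
  refine le_trans ?_ h0
  have hp0 : (0 : ℝ) < p := by exact_mod_cast hp.pos
  have hn0 : (0 : ℝ) < n := by exact_mod_cast hn
  have h1 : ∑ d ∈ (Icc 2 n).filter (fun d => ¬ p ∣ d), ((n : ℝ) * (d : ℝ)⁻¹ - 1) ≤
      ((∑ d ∈ (Icc 2 n).filter (fun d => ¬ p ∣ d), n / d : ℕ) : ℝ) := by
    rw [Nat.cast_sum]
    apply Finset.sum_le_sum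
    intro d hd
    simp only [Finset.mem_filter, Finset.mem_Icc] at hd
    have := Nat.lt_floor_add_one ((n : ℝ) / d)
    rw [Nat.floor_div_eq_div] at this
    rw [← div_eq_mul_inv]; linarith
  refine le_trans ?_ h1
  have h2 : (Icc 1 n).filter (fun d => ¬ p ∣ d) =
      insert 1 ((Icc 2 n).filter (fun d => ¬ p ∣ d)) := by
    ext d
    simp only [Finset.mem_filter, Finset.mem_Icc, Finset.mem_insert]
    constructor
    · rintro ⟨⟨a, b⟩, c⟩
      by_cases hd : d = 1
      · exact Or.inl hd
      · exact Or.inr ⟨⟨by omega, b⟩, c⟩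
    · rintro (rfl | ⟨⟨a, b⟩, c⟩)
      · exact ⟨⟨le_rfl, hn⟩, hp.one_lt.ne' ∘ Nat.dvd_one.mp⟩
      · exact ⟨⟨by omega, b⟩, c⟩
  have h3 := Finset.sum_filter_add_sum_filter_not (Icc 1 n) (fun d => p ∣ d)
    (fun d : ℕ => (n : ℝ) * (d : ℝ)⁻¹ - 1)
  rw [h2, Finset.sum_insert (by simp), sum_mult p n hp.pos] at h3
  have h4 : ∑ d ∈ Icc 1 n, ((n : ℝ) * (d : ℝ)⁻¹ - 1) = n * (harmonic n : ℝ) - n := by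
    rw [Finset.sum_sub_distrib, ← Finset.mul_sum, harm_sum]; simp
  have h5 : ∑ e ∈ Icc 1 (n / p), ((n : ℝ) * ((p * e : ℕ) : ℝ)⁻¹ - 1) =
      n / p * (harmonic (n / p) : ℝ) - (n / p : ℕ) := by
    rw [Finset.sum_sub_distrib, ← harm_sum, Finset.mul_sum]
    congr 1
    · apply Finset.sum_congr rfl
      intro e _
      push_cast
      rw [mul_inv]; ring
    · simp
  rw [h4, h5] at h3
  set m := n / p with hm
  have h6 : (harmonic m : ℝ) ≤ Real.eulerMascheroniConstant + Real.log (m + 1) := by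
    have := (Real.eulerMascheroniSeq_lt_eulerMascheroniConstant m).le
    simp only [Real.eulerMascheroniSeq] at this
    linarith
  have h7 : Real.eulerMascheroniConstant + Real.log n ≤ (harmonic n : ℝ) := by
    have := (Real.eulerMascheroniConstant_lt_eulerMascheroniSeq' n).le
    simp only [Real.eulerMascheroniSeq', hn.ne', if_false] at this
    linarith
  have h8 : Real.log (m + 1) ≤ Real.log n := by
    apply Real.log_le_log (by positivity)
    have : m < n := Nat.div_lt_self hn hp.one_lt
    exact_mod_cast this
  have h9 : (n : ℝ) / p ≤ m + 1 := by
    have := Nat.lt_floor_add_one ((n : ℝ) / p)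
    rw [Nat.floor_div_eq_div] at this
    exact this.le
  have h10 : (n : ℝ) / p * (harmonic m : ℝ) ≤
      n / p * (Real.eulerMascheroniConstant + Real.log n) :=
    mul_le_mul_of_nonneg_left (by linarith) (by positivity)
  have h11 := mul_le_mul_of_nonneg_left h7 hn0.le
  have h12 : ((p : ℝ) - 1) / p * n * Real.log n +
        n * (Real.eulerMascheroniConstant - 1 - ((p : ℝ) - 1) / p
          - Real.eulerMascheroniConstant / p) =
      n * (Real.eulerMascheroniConstant + Real.log n)
        - n / p * (Real.eulerMascheroniConstant + Real.log n) - 2 * n + n / p := by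
    field_simp
    ring
  rw [h12]
  simp only [Nat.cast_one, inv_one, mul_one] at h3
  linarith
end

section
/- Let p be a prime and n a positive integer. The cardinality of A_{p,n} equals 1 + ∑_{1 < r ≤ n, p ∤ r} ⌊n/r⌋. -/
open Finset

/-- `A_{p,n}`: the partitions of `n` of the form `(r^a, 1^b)` with `r` a positive integer
coprime to `p` and `a, b ≥ 0`. -/
def Apartitions (p n : ℕ) : Set (Nat.Partition n) :=
  {lam | ∃ r a b : ℕ, 0 < r ∧ Nat.Coprime r p ∧
    lam.parts = Multiset.replicate a r + Multiset.replicate b 1}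

def gfun14 (n : ℕ) : Option ((_ : ℕ) × ℕ) → Multiset ℕ
  | none => Multiset.replicate n 1
  | some ⟨r, a⟩ => Multiset.replicate a r + Multiset.replicate (n - a * r) 1

theorem gfun14_inj (n : ℕ) (S : Finset ((_ : ℕ) × ℕ)) (hS : ∀ x ∈ S, 2 ≤ x.1 ∧ 1 ≤ x.2) :
    Set.InjOn (gfun14 n) (Finset.insertNone S : Finset (Option ((_ : ℕ) × ℕ))) := by
  have key : ∀ x ∈ S, ∀ k, 2 ≤ k →
      Multiset.count k (gfun14 n (some x)) = if x.1 = k then x.2 else 0 := by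
    rintro ⟨r, a⟩ hx k hk
    have h1 : ¬ (1 = k) := by omega
    simp [gfun14, Multiset.count_replicate, h1]
  have key0 : ∀ k, 2 ≤ k → Multiset.count k (gfun14 n none) = 0 := by
    intro k hk
    have h1 : ¬ (1 = k) := by omega
    simp [gfun14, Multiset.count_replicate, h1]
  intro x hx y hy hxy
  rw [Finset.mem_coe] at hx hy
  rcases x with _ | x <;> rcases y with _ | y
  · rfl
  · have hy := Finset.some_mem_insertNone.1 hy
    have h1 := hS y hy
    have h2 := key y hy _ h1.1
    rw [← hxy, key0 _ h1.1] at h2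
    simp at h2; omega
  · have hx := Finset.some_mem_insertNone.1 hx
    have h1 := hS x hx
    have h2 := key x hx _ h1.1
    rw [hxy, key0 _ h1.1] at h2
    simp at h2; omega
  · have hx := Finset.some_mem_insertNone.1 hx
    have hy := Finset.some_mem_insertNone.1 hy
    have h1 := hS x hx
    have h2 := key x hx _ h1.1
    have h3 := key y hy _ h1.1
    rw [hxy, h3] at h2
    obtain ⟨r, a⟩ := x
    obtain ⟨s, b⟩ := y
    simp only [if_true] at h2
    split_ifs at h2 with h
    · subst h; subst h2; rfl
    · simp only at h1; omega

/-- `|A_{p,n}| = 1 + ∑_{1 < r ≤ n, p ∤ r} ⌊n/r⌋`. -/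
theorem stmt_14 (p n : ℕ) (hp : p.Prime) (hn : 0 < n) :
    (Apartitions p n).ncard =
      1 + ∑ r ∈ (Finset.Icc 2 n).filter (fun r => ¬ p ∣ r), n / r := by
  have hinj : Function.Injective (Nat.Partition.parts (n := n)) := by
    intro x y h
    exact Nat.Partition.ext h
  rw [← Set.ncard_image_of_injective _ hinj]
  set S : Finset ((_ : ℕ) × ℕ) :=
    ((Finset.Icc 2 n).filter (fun r => ¬ p ∣ r)).sigma (fun r => Finset.Icc 1 (n / r)) with hSdef
  have hS : ∀ x ∈ S, 2 ≤ x.1 ∧ 1 ≤ x.2 := by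
    intro x hx
    simp only [hSdef, Finset.mem_sigma, Finset.mem_filter, Finset.mem_Icc] at hx
    exact ⟨hx.1.1.1, hx.2.1⟩
  have himg : Nat.Partition.parts '' Apartitions p n =
      gfun14 n '' (Finset.insertNone S : Finset (Option ((_ : ℕ) × ℕ))) := by
    ext m
    constructor
    · rintro ⟨lam, ⟨r, a, b, hr, hc, hl⟩, rfl⟩
      have hsum := lam.parts_sum
      rw [hl] at hsum
      simp only [Multiset.sum_add, Multiset.sum_replicate, smul_eq_mul, mul_one] at hsum
      rw [hl]
      by_cases h : r = 1 ∨ a = 0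
      · refine ⟨none, by simp, ?_⟩
        rcases h with rfl | rfl
        · rw [← Multiset.replicate_add]
          simp only [gfun14]; congr 1; omega
        · simp only [gfun14, Multiset.replicate_zero, zero_add]; congr 1; omega
      · push Not at h
        refine ⟨some ⟨r, a⟩, ?_, ?_⟩
        · rw [Finset.mem_coe, Finset.some_mem_insertNone]
          simp only [hSdef, Finset.mem_sigma, Finset.mem_filter, Finset.mem_Icc]
          have ha : 1 ≤ a := by omega
          refine ⟨⟨⟨by omega, by nlinarith⟩, ?_⟩, ha, ?_⟩
          · exact (Nat.Prime.coprime_iff_not_dvd hp).1 hc.symm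
          · rw [Nat.le_div_iff_mul_le hr]; omega
        · simp only [gfun14]; congr 2; omega
    · rintro ⟨x, hx, rfl⟩
      rw [Finset.mem_coe] at hx
      rcases x with _ | ⟨r, a⟩
      · refine ⟨⟨Multiset.replicate n 1, ?_, by simp⟩, ⟨1, n, 0, one_pos, by simp, by simp⟩, rfl⟩
        intro i hi
        rw [Multiset.eq_of_mem_replicate hi]; exact one_pos
      · rw [Finset.some_mem_insertNone] at hx
        simp only [hSdef, Finset.mem_sigma, Finset.mem_filter, Finset.mem_Icc] at hx
        obtain ⟨⟨⟨h2, h3⟩, h4⟩, h5, h6⟩ := hx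
        rw [Nat.le_div_iff_mul_le (by omega)] at h6
        refine ⟨⟨Multiset.replicate a r + Multiset.replicate (n - a * r) 1, ?_, ?_⟩,
          ⟨r, a, n - a * r, by omega, ((Nat.Prime.coprime_iff_not_dvd hp).2 h4).symm, rfl⟩, rfl⟩
        · intro i hi
          rcases Multiset.mem_add.1 hi with hi | hi <;>
            rw [Multiset.eq_of_mem_replicate hi] <;> omega
        · simp only [Multiset.sum_add, Multiset.sum_replicate, smul_eq_mul, mul_one]; omega
  rw [himg, Set.ncard_image_of_injOn (gfun14_inj n S hS), Set.ncard_coe_finset,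
    Finset.card_insertNone, hSdef, Finset.card_sigma, add_comm]
  simp
end
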